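/- Let p be the distribution on {0,1}³ with coordinates (x, y, z) defined by p(x, y, z) = 1/4 if z = x XOR y and p(x, y, z) = 0 otherwise (i.e., x and y are independent uniform binary variables and z is their exclusive or). Then p is not faithful to any DAG on the three-element node set {x, y, z}: the conditional independencies of p (x ⊥ y, x ⊥ z, and y ⊥ z marginally, while each pair is dependent given the third variable) cannot be expressed exactly by the d-separations of any DAG on three nodes. -/

import Mathlib

open scoped Classical

namespace GroupBN

variable {V : Type*} {I : Type*}

/-- `u` and `v` are adjacent in the digraph with arc relation `A`. -/
def Adj (A : V → V → Prop) (u v : V) : Prop := A u v ∨ A v u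

/-- `A` is the arc relation of a DAG: there are no directed cycles
(in particular `A` is irreflexive). -/
def IsDAG (A : V → V → Prop) : Prop := ∀ v : V, ¬ Relation.TransGen A v v

/-- `u` is an ancestor of `v`: there is a nonempty directed path from `u` to `v`. -/
def Ancestor (A : V → V → Prop) (u v : V) : Prop := Relation.TransGen A u v

/-- `u` and `v` are d-connected given `Z`: there is a path (an injective sequence of
pairwise adjacent consecutive nodes) from `u` to `v` such that every head-to-head
interior node is in `Z` or has a descendant in `Z`, and no other interior node is
in `Z`. -/
def DConn (A : V → V → Prop) (Z : Set V) (u v : V) : Prop :=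
  ∃ (n : ℕ) (pth : Fin (n + 2) → V),
    Function.Injective pth ∧
    pth 0 = u ∧ pth (Fin.last (n + 1)) = v ∧
    (∀ (k : ℕ) (h : k + 1 < n + 2),
      Adj A (pth ⟨k, Nat.lt_of_succ_lt h⟩) (pth ⟨k + 1, h⟩)) ∧
    (∀ (k : ℕ) (h : k + 2 < n + 2),
      (A (pth ⟨k, by omega⟩) (pth ⟨k + 1, by omega⟩) ∧
         A (pth ⟨k + 2, h⟩) (pth ⟨k + 1, by omega⟩) →
        (pth ⟨k + 1, by omega⟩ ∈ Z ∨ ∃ d ∈ Z, Ancestor A (pth ⟨k + 1, by omega⟩) d)) ∧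
      (¬ (A (pth ⟨k, by omega⟩) (pth ⟨k + 1, by omega⟩) ∧
            A (pth ⟨k + 2, h⟩) (pth ⟨k + 1, by omega⟩)) →
        pth ⟨k + 1, by omega⟩ ∉ Z))

/-- `u` and `v` are d-separated by `Z`. -/
def DSep (A : V → V → Prop) (Z : Set V) (u v : V) : Prop := ¬ DConn A Z u v

/-- The node sets `X` and `Y` are d-separated by `Z`. -/
def DSepSet (A : V → V → Prop) (Z X Y : Set V) : Prop :=
  ∀ x ∈ X, ∀ y ∈ Y, DSep A Z x y

variable {S : V → Type*}

/-- `p` is a probability mass function on the joint state space. -/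
def IsDist [Fintype V] [DecidableEq V] [∀ v, Fintype (S v)]
    (p : (∀ v, S v) → ℝ) : Prop :=
  (∀ f, 0 ≤ p f) ∧ ∑ f, p f = 1

/-- Marginal probability, under `p`, of the event that the variables in `X` take
the values prescribed by the assignment `a`. -/
noncomputable def margin [Fintype V] [DecidableEq V] [∀ v, Fintype (S v)]
    (p : (∀ v, S v) → ℝ) (X : Set V) (a : ∀ v, S v) : ℝ :=
  ∑ f : ∀ v, S v, if ∀ v ∈ X, f v = a v then p f else 0

/-- Conditional independence `X ⊥ Y | Z` in `p`, in cross-multiplied form: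
for every assignment whose `Z`-part has positive probability,
`P(X,Y,Z) · P(Z) = P(X,Z) · P(Y,Z)`. -/
def CondIndep [Fintype V] [DecidableEq V] [∀ v, Fintype (S v)]
    (p : (∀ v, S v) → ℝ) (X Y Z : Set V) : Prop :=
  ∀ a : ∀ v, S v, 0 < margin p Z a →
    margin p (X ∪ Y ∪ Z) a * margin p Z a = margin p (X ∪ Z) a * margin p (Y ∪ Z) a

/-- `p` is faithful to the DAG `A`: conditional independence coincides with
d-separation for all pairwise disjoint `X`, `Y`, `Z` with `X`, `Y` nonempty. -/
def Faithful [Fintype V] [DecidableEq V] [∀ v, Fintype (S v)]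
    (p : (∀ v, S v) → ℝ) (A : V → V → Prop) : Prop :=
  ∀ X Y Z : Set V, X.Nonempty → Y.Nonempty →
    Disjoint X Y → Disjoint X Z → Disjoint Y Z →
    (CondIndep p X Y Z ↔ DSepSet A Z X Y)

/-- `p` is groupwise faithful to the group DAG `H` given the grouping whose groups
are the fibers of the surjection `π`. -/
def GroupwiseFaithful [Fintype V] [DecidableEq V] [∀ v, Fintype (S v)]
    (p : (∀ v, S v) → ℝ) (π : V → I) (H : I → I → Prop) : Prop :=
  ∀ i j : I, i ≠ j → ∀ T : Set I, i ∉ T → j ∉ T →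
    (CondIndep p (π ⁻¹' {i}) (π ⁻¹' {j}) (π ⁻¹' T) ↔ DSep H T i j)

/-- The variable DAG `A` is groupwise Markov equivalent to the group DAG `H`
given the grouping whose groups are the fibers of the surjection `π`. -/
def GroupwiseMarkovEquiv (A : V → V → Prop) (π : V → I) (H : I → I → Prop) : Prop :=
  ∀ i j : I, i ≠ j → ∀ T : Set I, i ∉ T → j ∉ T →
    (DSepSet A (π ⁻¹' T) (π ⁻¹' {i}) (π ⁻¹' {j}) ↔ DSep H T i j)

/-- Distinct adjacent nodes are d-connected given any set. -/
lemma Adj.dConn {A : V → V → Prop} {u v : V} (h : Adj A u v) (huv : u ≠ v) (Z : Set V) :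
    DConn A Z u v := by
  refine ⟨0, ![u, v], ?_, rfl, rfl, ?_, fun k hk => by omega⟩
  · intro a b
    fin_cases a <;> fin_cases b <;> simp [huv, huv.symm]
  · intro k hk
    obtain rfl : k = 0 := by omega
    exact h

/-- A node that is d-connected to some node is adjacent to some other node. -/
lemma DConn.exists_adj {A : V → V → Prop} {Z : Set V} {u v : V} (h : DConn A Z u v) :
    ∃ w, w ≠ u ∧ Adj A u w := by
  obtain ⟨n, pth, hinj, rfl, -, hadj, -⟩ := h
  exact ⟨pth ⟨1, by omega⟩, fun e => by simpa using hinj e, hadj 0 (by omega)⟩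

lemma sum_fin_three_fun_bool (F : (Fin 3 → Bool) → ℝ) :
    ∑ f, F f = ∑ a, ∑ b, ∑ c, F ![a, b, c] := by
  simp_rw [← Fintype.sum_prod_type']
  refine (Fintype.sum_bijective (fun x : Bool × Bool × Bool => ![x.1, x.2.1, x.2.2])
    (by decide) _ _ fun _ => rfl).symm

lemma xor_condIndep_zero_one :
    CondIndep (fun f : Fin 3 → Bool => if f 2 = xor (f 0) (f 1) then (1 / 4 : ℝ) else 0)
      {0} {1} ∅ := by
  intro a _
  simp only [margin, sum_fin_three_fun_bool]
  cases h0 : a 0 <;> cases h1 : a 1 <;> simp [h0, h1] <;> norm_num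

lemma xor_condIndep_zero_two :
    CondIndep (fun f : Fin 3 → Bool => if f 2 = xor (f 0) (f 1) then (1 / 4 : ℝ) else 0)
      {0} {2} ∅ := by
  intro a _
  simp only [margin, sum_fin_three_fun_bool]
  cases h0 : a 0 <;> cases h2 : a 2 <;> simp [h0, h2] <;> norm_num

lemma xor_not_condIndep_zero_one_given_two :
    ¬ CondIndep (fun f : Fin 3 → Bool => if f 2 = xor (f 0) (f 1) then (1 / 4 : ℝ) else 0)
      {0} {1} {2} := by
  intro h
  have := h (fun _ => false)
  simp only [margin, sum_fin_three_fun_bool] at this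
  simp at this

/-- the XOR distribution is unfaithful. The distribution on
three binary variables in which the first two coordinates are independent fair
coins and the third is their exclusive or is not faithful to any DAG on three
nodes. -/
theorem xor_distribution_not_faithful :
    ∀ G : Fin 3 → Fin 3 → Prop, IsDAG G →
      ¬ Faithful
        (fun f : Fin 3 → Bool => if f 2 = xor (f 0) (f 1) then (1 / 4 : ℝ) else 0)
        G := by
  intro G _ hF
  have not_adj (w : Fin 3) (hw : w ≠ 0)
      (hI : CondIndep
        (fun f : Fin 3 → Bool => if f 2 = xor (f 0) (f 1) then (1 / 4 : ℝ) else 0)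
        {0} {w} ∅) : ¬ Adj G 0 w := fun hadj =>
    (hF {0} {w} ∅ (by simp) (by simp) (by simpa using hw.symm) (by simp) (by simp)).1 hI
      0 rfl w rfl (hadj.dConn hw.symm ∅)
  refine xor_not_condIndep_zero_one_given_two
    ((hF {0} {1} {2} (by simp) (by simp) (by simp) (by simp) (by simp)).2 ?_)
  rintro _ rfl y - hconn
  obtain ⟨w, hw, hadj⟩ := hconn.exists_adj
  fin_cases w
  · exact hw rfl
  · exact not_adj 1 (by decide) xor_condIndep_zero_one hadj
  · exact not_adj 2 (by decide) xor_condIndep_zero_two hadj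

end GroupBN
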